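/- Under the standing assumptions with 0 < γ < μ_f/‖A‖², the iterates of AMA (y^{k+1} = T_γ(y^k), x^k = x(y^k), z^k = z_γ(y^k)) satisfy: the dual values ψ(y^k) are nonincreasing, ∑_{k≥1} ‖Ax^k - z^k‖² < ∞ (hence Ax^k - z^k → 0), x^k → x⋆ (the unique primal solution), and every cluster point of {y^k} is a dual minimizer. -/

import Mathlib

open scoped InnerProductSpace RealInnerProductSpace
open Filter Topology

noncomputable section

abbrev E (n : ℕ) := EuclideanSpace ℝ (Fin n)

/-- Convexity for extended-real-valued functions. -/
def EConvexOn {n : ℕ} (f : E n → EReal) : Prop :=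
  ∀ x y : E n, ∀ a b : ℝ, 0 ≤ a → 0 ≤ b → a + b = 1 →
    f (a • x + b • y) ≤ (a : EReal) * f x + (b : EReal) * f y

def ProperFun {n : ℕ} (f : E n → EReal) : Prop :=
  (∃ x, f x ≠ ⊤) ∧ ∀ x, f x ≠ ⊥

def ProperClosedConvex {n : ℕ} (f : E n → EReal) : Prop :=
  ProperFun f ∧ LowerSemicontinuous f ∧ EConvexOn f

/-- `f` is strongly convex with modulus `μ`: `f - (μ/2)‖·‖²` is convex. -/
def StronglyConvexWithMod {n : ℕ} (μ : ℝ) (f : E n → EReal) : Prop :=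
  EConvexOn (fun x => f x - ((μ / 2 * ‖x‖ ^ 2 : ℝ) : EReal))

/-- Fenchel conjugate. -/
def conjFn {n : ℕ} (f : E n → EReal) (y : E n) : EReal :=
  ⨆ x : E n, ((⟪x, y⟫_ℝ : ℝ) : EReal) - f x

/-- Convex subdifferential. -/
def Subdiff {n : ℕ} (f : E n → EReal) (x : E n) : Set (E n) :=
  {v | ∀ z, f x + ((⟪v, z - x⟫_ℝ : ℝ) : EReal) ≤ f z}

/-- `p` is the proximal point of `x` for `h` with stepsize `γ`. -/
def IsProx {n : ℕ} (γ : ℝ) (h : E n → EReal) (x p : E n) : Prop :=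
  ∀ z : E n, h p + ((1 / (2 * γ) * ‖p - x‖ ^ 2 : ℝ) : EReal) ≤
    h z + ((1 / (2 * γ) * ‖z - x‖ ^ 2 : ℝ) : EReal)

/-- Moreau envelope. -/
def moreauEnv {n : ℕ} (γ : ℝ) (h : E n → EReal) (x : E n) : EReal :=
  ⨅ z : E n, h z + ((1 / (2 * γ) * ‖z - x‖ ^ 2 : ℝ) : EReal)

/-- Dual objective `ψ(y) = f*(-Aᵀy) + g*(y)`. -/
def dualObj {n m : ℕ} (f : E n → EReal) (g : E m → EReal) (A : E n →L[ℝ] E m)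
    (y : E m) : EReal :=
  conjFn f (-(ContinuousLinearMap.adjoint A y)) + conjFn g y

/-- The alternating minimization envelope `ψ_γ(y) = -L_γ(x(y), z_γ(y), y)`. -/
def AME {n m : ℕ} (f : E n → EReal) (g : E m → EReal) (A : E n →L[ℝ] E m)
    (γ : ℝ) (xmin : E m → E n) (zmin : E m → E m) (y : E m) : EReal :=
  -(f (xmin y) + g (zmin y)
    + ((⟪y, A (xmin y) - zmin y⟫_ℝ + γ / 2 * ‖A (xmin y) - zmin y‖ ^ 2 : ℝ) : EReal))



lemma aux_quad (a b : ℝ) (h : ∀ t : ℝ, 0 < t → t < 1 → 0 ≤ t * a + t ^ 2 * b) : 0 ≤ a := by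
  by_contra hneg
  push Not at hneg
  have hb : 0 < |b| + 1 := by positivity
  set t := min (1/2) (-a / (2 * (|b| + 1))) with ht
  have ht0 : 0 < t := lt_min (by norm_num) (div_pos (by linarith) (by linarith))
  have ht1 : t < 1 := lt_of_le_of_lt (min_le_left _ _) (by norm_num)
  have h2 : t ≤ -a / (2 * (|b| + 1)) := min_le_right _ _
  rw [le_div_iff₀ (by linarith)] at h2
  have := h t ht0 ht1
  have h3 : 0 ≤ t * (a + t * b) := by nlinarith
  have h4 : 0 ≤ a + t * b := nonneg_of_mul_nonneg_right h3 ht0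
  nlinarith [le_abs_self b, mul_le_mul_of_nonneg_left (le_abs_self b) ht0.le]

lemma aux_ge_coe {e : EReal} {a b c : ℝ} (hb : e ≠ ⊥) (h : (a : EReal) ≤ e + (b : EReal))
    (h2 : e ≤ (c : EReal)) : a ≤ c + b := by
  induction e with
  | bot => exact absurd rfl hb
  | top => simp at h2
  | coe x =>
    norm_cast at h h2
    linarith

lemma sc_min {n m : ℕ} {μ : ℝ} {f : E n → EReal} (A : E n →L[ℝ] E m)
    (hbot : ∀ x, f x ≠ ⊥) (hsc : StronglyConvexWithMod μ f) {u x : E n} {a b : ℝ} (y : E m)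
    (hu : f u = a) (hxx : f x = b)
    (hmin : ∀ v, f u + ((⟪y, A u⟫_ℝ : ℝ) : EReal) ≤ f v + ((⟪y, A v⟫_ℝ : ℝ) : EReal)) :
    a + ⟪y, A u⟫_ℝ + μ / 2 * ‖x - u‖ ^ 2 ≤ b + ⟪y, A x⟫_ℝ := by
  have key := aux_quad (b + ⟪y, A x⟫_ℝ - (a + ⟪y, A u⟫_ℝ + μ / 2 * ‖x - u‖ ^ 2))
    (μ / 2 * ‖x - u‖ ^ 2) ?_
  · linarith
  intro t ht0 ht1
  have h1 := hsc u x (1 - t) t (by linarith) ht0.le (by ring)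
  have h2 := hmin ((1 - t) • u + t • x)
  simp only [hu, hxx] at h1 h2
  have hb := hbot ((1 - t) • u + t • x)
  have hn : ‖(1 - t) • u + t • x‖ ^ 2 = (1 - t) * ‖u‖ ^ 2 + t * ‖x‖ ^ 2
      - t * (1 - t) * ‖x - u‖ ^ 2 := by
    rw [norm_add_sq_real, norm_sub_sq_real, norm_smul, norm_smul, mul_pow, mul_pow,
      Real.norm_eq_abs, Real.norm_eq_abs, sq_abs, sq_abs, inner_smul_left, inner_smul_right,
      real_inner_comm x u]
    simp
    ring
  rw [hn] at h1
  rw [map_add, map_smul, map_smul, inner_add_right, inner_smul_right, inner_smul_right] at h2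
  generalize f ((1 - t) • u + t • x) = e at h1 h2 hb
  induction e with
  | bot => exact absurd rfl hb
  | top =>
    exfalso
    revert h1
    rw [EReal.top_sub_coe]
    norm_cast
    simp only [top_le_iff]
    exact EReal.coe_ne_top _
  | coe c =>
    norm_cast at h1 h2
    nlinarith

lemma prox_sub {m : ℕ} {γ : ℝ} (hγ : 0 < γ) {g : E m → EReal}
    (hbot : ∀ x, g x ≠ ⊥) (hc : EConvexOn g) {c z w : E m} {a b : ℝ}
    (hzz : g z = a) (hw : g w = b) (hp : IsProx γ⁻¹ g c z) :
    a + ⟪γ • (c - z), w - z⟫_ℝ ≤ b := by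
  have key := aux_quad (b - a - ⟪γ • (c - z), w - z⟫_ℝ) (γ / 2 * ‖w - z‖ ^ 2) ?_
  · linarith
  intro t ht0 ht1
  have h1 := hc z w (1 - t) t (by linarith) ht0.le (by ring)
  have h2 := hp ((1 - t) • z + t • w)
  simp only [hzz, hw] at h1 h2
  have hb := hbot ((1 - t) • z + t • w)
  have hn : ‖(1 - t) • z + t • w - c‖ ^ 2 = ‖z - c‖ ^ 2 - 2 * t * ⟪c - z, w - z⟫_ℝ
      + t ^ 2 * ‖w - z‖ ^ 2 := by
    have : (1 - t) • z + t • w - c = t • (w - z) - (c - z) := by module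
    rw [this, norm_sub_sq_real, norm_smul, mul_pow, Real.norm_eq_abs, sq_abs, inner_smul_left,
      real_inner_comm, norm_sub_rev c z]
    simp
    ring
  have hg2 : 1 / (2 * γ⁻¹) = γ / 2 := by field_simp
  rw [hn, hg2] at h2
  rw [inner_smul_left]
  simp only [conj_trivial]
  generalize g ((1 - t) • z + t • w) = e at h1 h2 hb
  induction e with
  | bot => exact absurd rfl hb
  | top =>
    exfalso
    revert h1
    norm_cast
    simp only [top_le_iff]
    exact EReal.coe_ne_top _
  | coe c =>
    norm_cast at h1 h2
    nlinarith

lemma conj_le {n : ℕ} {f : E n → EReal} {q : E n} {C : ℝ} (hbot : ∀ x, f x ≠ ⊥)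
    (h : ∀ x (b : ℝ), f x = b → ⟪x, q⟫_ℝ - b ≤ C) : conjFn f q ≤ C := by
  refine iSup_le fun x => ?_
  have hb := hbot x
  have h1 := h x
  generalize f x = e at *
  induction e with
  | bot => exact absurd rfl hb
  | top => simp
  | coe c => have := h1 c rfl; exact_mod_cast this

lemma le_conj {n : ℕ} {f : E n → EReal} {q : E n} {x : E n} {b : ℝ} (h : f x = b) :
    ((⟪x, q⟫_ℝ - b : ℝ) : EReal) ≤ conjFn f q := by
  have := le_iSup (fun x : E n => ((⟪x, q⟫_ℝ : ℝ) : EReal) - f x) x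
  simp only [h] at this
  exact_mod_cast this

/-- lower bound of the dual objective -/
lemma le_dual {n m : ℕ} {f : E n → EReal} {g : E m → EReal} (A : E n →L[ℝ] E m)
    {x : E n} {z y : E m} {a b : ℝ} (hfx : f x = a) (hgz : g z = b) :
    ((-(a + b + ⟪y, A x - z⟫_ℝ) : ℝ) : EReal) ≤ dualObj f g A y := by
  have h1 := le_conj (q := -(ContinuousLinearMap.adjoint A y)) hfx
  have h2 := le_conj (q := y) hgz
  refine le_trans ?_ (add_le_add h1 h2)
  norm_cast
  rw [inner_neg_right, ContinuousLinearMap.adjoint_inner_right, inner_sub_right,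
    real_inner_comm y (A x), real_inner_comm y z]
  linarith

/-- key descent bound -/
lemma dual_step {n m : ℕ} {μ γ : ℝ} (hμ : 0 < μ) (hγ : 0 < γ)
    {f : E n → EReal} {g : E m → EReal} (A : E n →L[ℝ] E m)
    (hfb : ∀ x, f x ≠ ⊥) (hsc : StronglyConvexWithMod μ f)
    (hgb : ∀ x, g x ≠ ⊥) (hgc : EConvexOn g)
    {u : E n} {z y : E m} {a b : ℝ} (hu : f u = a) (hzz : g z = b)
    (hmin : ∀ v, f u + ((⟪y, A u⟫_ℝ : ℝ) : EReal) ≤ f v + ((⟪y, A v⟫_ℝ : ℝ) : EReal))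
    (hp : IsProx γ⁻¹ g (γ⁻¹ • y + A u) z) (hγA : γ * ‖A‖ ^ 2 ≤ μ) :
    dualObj f g A (y + γ • (A u - z)) ≤
      ((-(a + b + ⟪y, A u - z⟫_ℝ + γ / 2 * ‖A u - z‖ ^ 2) : ℝ) : EReal) := by
  set r := A u - z with hr
  have h2 : conjFn g (y + γ • r) ≤ ((⟪z, y + γ • r⟫_ℝ - b : ℝ) : EReal) := by
    refine conj_le hgb fun w c hw => ?_
    have := prox_sub hγ hgb hgc hzz hw hp
    have e : γ • (γ⁻¹ • y + A u - z) = y + γ • r := by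
      rw [hr, add_sub_assoc, smul_add, smul_inv_smul₀ hγ.ne']
    rw [e, inner_sub_right, real_inner_comm, real_inner_comm z] at this
    linarith
  have h1 : conjFn f (-(ContinuousLinearMap.adjoint A (y + γ • r))) ≤
      ((-a - ⟪y + γ • r, A u⟫_ℝ + γ / 2 * ‖r‖ ^ 2 : ℝ) : EReal) := by
    refine conj_le hfb fun x c hc => ?_
    have h3 := sc_min A hfb hsc y hu hc hmin
    rw [inner_neg_right, ContinuousLinearMap.adjoint_inner_right, real_inner_comm,
      inner_add_left, inner_add_left, inner_smul_left, inner_smul_left]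
    simp only [conj_trivial]
    have h4 : ⟪r, A u⟫_ℝ - ⟪r, A x⟫_ℝ ≤ ‖r‖ * (‖A‖ * ‖x - u‖) := by
      have : ⟪r, A u⟫_ℝ - ⟪r, A x⟫_ℝ = ⟪r, A (u - x)⟫_ℝ := by rw [map_sub, inner_sub_right]
      rw [this, norm_sub_rev x u]
      exact (real_inner_le_norm _ _).trans
        (mul_le_mul_of_nonneg_left (A.le_opNorm _) (norm_nonneg _))
    have h5 : γ * (‖r‖ * (‖A‖ * ‖x - u‖)) ≤ γ / 2 * ‖r‖ ^ 2 + μ / 2 * ‖x - u‖ ^ 2 := by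
      have : γ * ‖A‖ ^ 2 * ‖x - u‖ ^ 2 ≤ μ * ‖x - u‖ ^ 2 :=
        mul_le_mul_of_nonneg_right hγA (sq_nonneg _)
      nlinarith [mul_nonneg hγ.le (sq_nonneg (‖r‖ - ‖A‖ * ‖x - u‖))]
    have h6 := mul_le_mul_of_nonneg_left h4 hγ.le
    linarith
  refine (add_le_add h1 h2).trans ?_
  norm_cast
  have h7 : ⟪y + γ • r, A u⟫_ℝ - ⟪z, y + γ • r⟫_ℝ = ⟪y, r⟫_ℝ + γ * ‖r‖ ^ 2 := by
    rw [real_inner_comm, ← inner_sub_left, ← hr, inner_add_right, inner_smul_right,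
      real_inner_self_eq_norm_sq, real_inner_comm]
  linarith

lemma lsc_conj {n : ℕ} (f : E n → EReal) : LowerSemicontinuous (conjFn f) := by
  refine lowerSemicontinuous_iSup fun x => ?_
  generalize f x = e
  induction e with
  | bot => simp only [EReal.coe_sub_bot]; exact lowerSemicontinuous_const
  | top => simp only [EReal.sub_top]; exact lowerSemicontinuous_const
  | coe c =>
    simp only [← EReal.coe_sub]
    refine Continuous.lowerSemicontinuous ?_
    exact continuous_coe_real_ereal.comp (by fun_prop)

lemma conj_ne_bot {n : ℕ} {f : E n → EReal} (h : ∃ x, f x ≠ ⊤) (hbot : ∀ x, f x ≠ ⊥) (q : E n) :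
    conjFn f q ≠ ⊥ := by
  obtain ⟨x, hx⟩ := h
  have := le_conj (q := q) (EReal.coe_toReal hx (hbot x)).symm
  intro h
  rw [h, le_bot_iff] at this
  exact EReal.coe_ne_bot _ this

lemma lsc_dual {n m : ℕ} (f : E n → EReal) (g : E m → EReal) (A : E n →L[ℝ] E m)
    (hf : ProperFun f) (hg : ProperFun g) : LowerSemicontinuous (dualObj f g A) := by
  intro y
  have h1 : LowerSemicontinuous
      (fun y => conjFn f (-(ContinuousLinearMap.adjoint A y))) :=
    (lsc_conj f).comp (by fun_prop)
  refine LowerSemicontinuousAt.add' (h1 y) (lsc_conj g y) ?_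
  exact EReal.continuousAt_add (Or.inr (conj_ne_bot hg.1 hg.2 _))
    (Or.inl (conj_ne_bot hf.1 hf.2 _))

/-- Global convergence of AMA: for `0 < γ < μ_f/‖A‖²`, the dual values are
nonincreasing, the squared residuals are summable, the primal iterates converge
to the unique primal solution and every cluster point of the dual iterates is
a dual minimizer. -/
theorem AMA_global_convergence
    {n m : ℕ} (μ γ : ℝ) (hμ : 0 < μ) (hγ : 0 < γ)
    (f : E n → EReal) (g : E m → EReal) (A : E n →L[ℝ] E m)
    (hf : ProperClosedConvex f) (hsc : StronglyConvexWithMod μ f)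
    (hg : ProperClosedConvex g)
    (hfeas : ∃ x, f x ≠ ⊤ ∧ g (A x) ≠ ⊤)
    (xmin : E m → E n)
    (hx : ∀ y x, f (xmin y) + ((⟪y, A (xmin y)⟫_ℝ : ℝ) : EReal)
        ≤ f x + ((⟪y, A x⟫_ℝ : ℝ) : EReal))
    (zmin : E m → E m)
    (hz : ∀ y, IsProx γ⁻¹ g (γ⁻¹ • y + A (xmin y)) (zmin y))
    (hγA : γ < μ / ‖A‖ ^ 2)
    (xstar : E n) (hxstar : ∀ x, f xstar + g (A xstar) ≤ f x + g (A x))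
    (y : ℕ → E m)
    (hrec : ∀ k, y (k + 1) = y k + γ • (A (xmin (y k)) - zmin (y k))) :
    (∀ k, dualObj f g A (y (k + 1)) ≤ dualObj f g A (y k)) ∧
    Summable (fun k : ℕ => ‖A (xmin (y (k + 1))) - zmin (y (k + 1))‖ ^ 2) ∧
    Tendsto (fun k : ℕ => A (xmin (y k)) - zmin (y k)) atTop (nhds 0) ∧
    Tendsto (fun k : ℕ => xmin (y k)) atTop (nhds xstar) ∧
    (∀ ybar : E m, MapClusterPt ybar atTop y →
      ∀ w, dualObj f g A ybar ≤ dualObj f g A w) := by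
  obtain ⟨⟨hfp, hfb⟩, hfl, -⟩ := hf
  obtain ⟨⟨hgp, hgb⟩, hgl, hgc⟩ := hg
  obtain ⟨x0, hx0, hz0⟩ := hfeas
  have hA : 0 < ‖A‖ ^ 2 := by
    by_contra h
    have : ‖A‖ ^ 2 = 0 := le_antisymm (not_lt.1 h) (sq_nonneg _)
    rw [this, div_zero] at hγA
    linarith
  have hγA' : γ * ‖A‖ ^ 2 ≤ μ := ((lt_div_iff₀ hA).1 hγA).le
  have hxtop : ∀ y, f (xmin y) ≠ ⊤ := by
    intro y h
    have := hx y x0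
    rw [h, EReal.top_add_coe, top_le_iff, ← EReal.coe_toReal hx0 (hfb x0)] at this
    exact EReal.coe_ne_top _ (by exact_mod_cast this)
  have hztop : ∀ y, g (zmin y) ≠ ⊤ := by
    intro y h
    have := hz y (A x0)
    rw [h, EReal.top_add_coe, top_le_iff, ← EReal.coe_toReal hz0 (hgb _)] at this
    exact EReal.coe_ne_top _ (by exact_mod_cast this)
  have hsle := hxstar x0
  have hslt : f xstar + g (A xstar) ≠ ⊤ := by
    intro h
    rw [h, top_le_iff] at hsle
    exact EReal.add_ne_top hx0 hz0 hsle
  have hfs : f xstar ≠ ⊤ := fun h => hslt (by rw [h, EReal.top_add_of_ne_bot (hgb _)])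
  have hgs : g (A xstar) ≠ ⊤ := fun h => hslt (by rw [h, EReal.add_top_of_ne_bot (hfb _)])
  obtain ⟨a, ha⟩ : ∃ a : ℕ → ℝ, ∀ k, f (xmin (y k)) = a k :=
    ⟨fun k => (f (xmin (y k))).toReal, fun k => (EReal.coe_toReal (hxtop _) (hfb _)).symm⟩
  obtain ⟨b, hb⟩ : ∃ b : ℕ → ℝ, ∀ k, g (zmin (y k)) = b k :=
    ⟨fun k => (g (zmin (y k))).toReal, fun k => (EReal.coe_toReal (hztop _) (hgb _)).symm⟩
  obtain ⟨as, has⟩ : ∃ c : ℝ, f xstar = c := ⟨_, (EReal.coe_toReal hfs (hfb _)).symm⟩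
  obtain ⟨bs, hbs⟩ : ∃ c : ℝ, g (A xstar) = c := ⟨_, (EReal.coe_toReal hgs (hgb _)).symm⟩
  obtain ⟨r, hr⟩ : ∃ r : ℕ → E m, ∀ k, r k = A (xmin (y k)) - zmin (y k) := ⟨_, fun k => rfl⟩
  obtain ⟨F, hF⟩ : ∃ F : ℕ → ℝ, ∀ k, F k = -(a k + b k + ⟪y k, r k⟫_ℝ + γ / 2 * ‖r k‖ ^ 2) :=
    ⟨_, fun k => rfl⟩
  simp only [← hr] at hrec ⊢
  have hup : ∀ k, dualObj f g A (y (k + 1)) ≤ (F k : EReal) := by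
    intro k
    rw [hrec, hF, hr]
    exact dual_step hμ hγ A hfb hsc hgb hgc (ha k) (hb k) (hx (y k)) (hz (y k)) hγA'
  have hlow : ∀ k, ((F k + γ / 2 * ‖r k‖ ^ 2 : ℝ) : EReal) ≤ dualObj f g A (y k) := by
    intro k
    have := le_dual A (y := y k) (ha k) (hb k)
    rw [← hr] at this
    convert this using 2
    rw [hF]; ring
  have hweak : ∀ w, ((-(as + bs) : ℝ) : EReal) ≤ dualObj f g A w := by
    intro w
    have := le_dual A (y := w) has hbs
    simpa using this
  have hdesc : ∀ k, F (k + 1) + γ / 2 * ‖r (k + 1)‖ ^ 2 ≤ F k := fun k => by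
    exact_mod_cast (hlow (k + 1)).trans (hup k)
  have hFlow : ∀ k, -(as + bs) ≤ F k := fun k => by
    exact_mod_cast (hweak (y (k + 1))).trans (hup k)
  have hFanti : Antitone F := antitone_nat_of_succ_le fun k => by
    have := hdesc k
    have : 0 ≤ γ / 2 * ‖r (k + 1)‖ ^ 2 := by positivity
    linarith [hdesc k]
  have hsum : Summable (fun k => ‖r (k + 1)‖ ^ 2) := by
    refine summable_of_sum_range_le (c := 2 / γ * (F 0 + (as + bs))) (fun _ => sq_nonneg _) ?_
    intro N
    have h : ∀ N, γ / 2 * ∑ i ∈ Finset.range N, ‖r (i + 1)‖ ^ 2 ≤ F 0 - F N := by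
      intro N
      induction N with
      | zero => simp
      | succ N ih => rw [Finset.sum_range_succ, mul_add]; linarith [hdesc N]
    have h1 := h N
    have h2 := hFlow N
    have h3 : γ / 2 * ∑ i ∈ Finset.range N, ‖r (i + 1)‖ ^ 2 ≤ F 0 + (as + bs) := by linarith
    calc _ = 2 / γ * (γ / 2 * ∑ i ∈ Finset.range N, ‖r (i + 1)‖ ^ 2) := by field_simp
      _ ≤ _ := mul_le_mul_of_nonneg_left h3 (by positivity)
  have hsq0 : Tendsto (fun k => ‖r k‖ ^ 2) atTop (𝓝 0) :=
    (tendsto_add_atTop_iff_nat 1).1 hsum.tendsto_atTop_zero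
  have hr0 : Tendsto r atTop (𝓝 0) := by
    rw [tendsto_zero_iff_norm_tendsto_zero]
    have := hsq0.sqrt
    simpa [Real.sqrt_sq] using this
  -- distance to the solution
  have hdist : ∀ k, μ / 2 * ‖xstar - xmin (y (k + 1))‖ ^ 2 ≤ F k + (as + bs) := by
    intro k
    have h1 := sc_min A hfb hsc (y (k + 1)) (ha (k + 1)) has (hx (y (k + 1)))
    have h2 : conjFn f (-(ContinuousLinearMap.adjoint A (y (k + 1)))) ≥
      ((⟪xmin (y (k + 1)), -(ContinuousLinearMap.adjoint A (y (k + 1)))⟫_ℝ - a (k + 1) : ℝ) :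
        EReal) := le_conj (ha (k + 1))
    have h3 : conjFn g (y (k + 1)) ≥ ((⟪A xstar, y (k + 1)⟫_ℝ - bs : ℝ) : EReal) := le_conj hbs
    have h4 := (add_le_add h2 h3).trans (hup k)
    norm_cast at h4
    rw [inner_neg_right, ContinuousLinearMap.adjoint_inner_right, real_inner_comm,
      real_inner_comm _ (A xstar)] at h4
    linarith
  -- infinitely many indices with inner product not too negative
  have hfreq : ∀ ε : ℝ, 0 < ε → ∃ᶠ k in atTop, -ε ≤ ⟪y k, r k⟫_ℝ := by
    intro ε hε hcon
    have hev : ∀ᶠ k in atTop, ‖y (k + 1)‖ ^ 2 ≤ ‖y k‖ ^ 2 - γ * ε := by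
      have h1 : ∀ᶠ k in atTop, ‖r k‖ ^ 2 < ε / γ :=
        hsq0.eventually (gt_mem_nhds (by positivity))
      filter_upwards [hcon, h1] with k hk h1
      push Not at hk
      rw [lt_div_iff₀ hγ] at h1
      rw [hrec, norm_add_sq_real, norm_smul, mul_pow, Real.norm_eq_abs, sq_abs, inner_smul_right]
      have h2 := mul_le_mul_of_nonneg_left h1.le hγ.le
      have h3 := mul_le_mul_of_nonneg_left hk.le hγ.le
      nlinarith
    obtain ⟨K, hK⟩ := eventually_atTop.1 hev
    have h2 : ∀ j : ℕ, ‖y (K + j)‖ ^ 2 ≤ ‖y K‖ ^ 2 - j * (γ * ε) := by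
      intro j
      induction j with
      | zero => simp
      | succ j ih =>
        have := hK (K + j) (by omega)
        rw [← add_assoc]
        push_cast
        linarith
    obtain ⟨j, hj⟩ := exists_nat_gt (‖y K‖ ^ 2 / (γ * ε))
    rw [div_lt_iff₀ (by positivity)] at hj
    nlinarith [h2 j, sq_nonneg ‖y (K + j)‖]
  have hsmall : ∀ ε : ℝ, 0 < ε → ∃ k, F k ≤ -(as + bs) + 3 * ε := by
    intro ε hε
    obtain ⟨φ, hφ, hφp⟩ := extraction_of_frequently_atTop (hfreq ε hε)
    have hbdd : ∀ k, xmin (y (φ (k + 1))) ∈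
        Metric.closedBall xstar (Real.sqrt (2 / μ * (F 0 + (as + bs)))) := by
      intro k
      obtain ⟨j, hj⟩ : ∃ j, φ (k + 1) = j + 1 :=
        Nat.exists_eq_succ_of_ne_zero (by have := hφ.id_le (k + 1); simp at this; omega)
      rw [hj, mem_closedBall_iff_norm']
      apply Real.le_sqrt_of_sq_le
      have h1 := hdist j
      have h2 := hFanti (Nat.zero_le j)
      calc ‖xstar - xmin (y (j + 1))‖ ^ 2
          = 2 / μ * (μ / 2 * ‖xstar - xmin (y (j + 1))‖ ^ 2) := by field_simp
        _ ≤ _ := mul_le_mul_of_nonneg_left (by linarith) (by positivity)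
    obtain ⟨xb, -, θ, hθ, hlim⟩ := (isCompact_closedBall _ _).tendsto_subseq hbdd
    set s : ℕ → ℕ := fun k => φ (θ k + 1) with hs
    have hst : Tendsto s atTop atTop :=
      hφ.tendsto_atTop.comp ((tendsto_add_atTop_nat 1).comp hθ.tendsto_atTop)
    have hxl : Tendsto (fun k => xmin (y (s k))) atTop (𝓝 xb) := hlim
    have hzl : Tendsto (fun k => zmin (y (s k))) atTop (𝓝 (A xb)) := by
      have h1 := ((A.continuous.tendsto xb).comp hxl).sub (hr0.comp hst)
      rw [sub_zero] at h1
      refine h1.congr fun k => ?_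
      simp [hr]
    have hge : ((as + bs : ℝ) : EReal) ≤ f xb + g (A xb) := by
      have := hxstar xb
      rw [has, hbs] at this
      exact_mod_cast this
    -- real numbers below
    have hlt : ∃ p q : ℝ, (p : EReal) < f xb ∧ (q : EReal) < g (A xb) ∧ as + bs - ε ≤ p + q := by
      have hfb' := hfb xb
      have hgb' := hgb (A xb)
      generalize f xb = e1 at *
      generalize g (A xb) = e2 at *
      induction e1 with
      | bot => exact absurd rfl hfb'
      | top =>
        induction e2 with
        | bot => exact absurd rfl hgb'
        | top => exact ⟨as + bs, 0, EReal.coe_lt_top _, EReal.coe_lt_top _, by linarith⟩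
        | coe c2 =>
          exact ⟨as + bs - c2 + 1, c2 - 1, EReal.coe_lt_top _, by norm_cast; linarith, by linarith⟩
      | coe c1 =>
        induction e2 with
        | bot => exact absurd rfl hgb'
        | top =>
          exact ⟨c1 - 1, as + bs - c1 + 1, by norm_cast; linarith, EReal.coe_lt_top _, by linarith⟩
        | coe c2 =>
          norm_cast at hge
          exact ⟨c1 - ε / 2, c2 - ε / 2, by norm_cast; linarith, by norm_cast; linarith,
            by linarith⟩
    obtain ⟨p, q, hp, hq, hpq⟩ := hlt
    obtain ⟨k, hk1, hk2⟩ := ((hxl.eventually (hfl xb p hp)).and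
      (hzl.eventually (hgl (A xb) q hq))).exists
    rw [ha] at hk1
    rw [hb] at hk2
    norm_cast at hk1 hk2
    refine ⟨s k, ?_⟩
    have h5 : -ε ≤ ⟪y (s k), r (s k)⟫_ℝ := hφp (θ k + 1)
    have h6 : 0 ≤ γ / 2 * ‖r (s k)‖ ^ 2 := by positivity
    rw [hF]
    linarith
  have hFlim : Tendsto F atTop (𝓝 (-(as + bs))) := by
    rw [Metric.tendsto_atTop]
    intro ε hε
    obtain ⟨N, hN⟩ := hsmall (ε / 4) (by positivity)
    refine ⟨N, fun k hk => ?_⟩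
    rw [Real.dist_eq, abs_lt]
    constructor <;> linarith [hFlow k, hFanti hk]
  refine ⟨fun k => ?_, hsum, hr0, ?_, ?_⟩
  · refine (hup k).trans (le_trans ?_ (hlow k))
    have : 0 ≤ γ / 2 * ‖r k‖ ^ 2 := by positivity
    norm_cast
    linarith
  · rw [← tendsto_add_atTop_iff_nat 1, tendsto_iff_norm_sub_tendsto_zero]
    have h1 : Tendsto (fun k => Real.sqrt (2 / μ * (F k + (as + bs)))) atTop (𝓝 0) := by
      have := ((hFlim.add_const (as + bs)).const_mul (2 / μ)).sqrt
      simpa using this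
    refine squeeze_zero (fun _ => norm_nonneg _) (fun k => ?_) h1
    apply Real.le_sqrt_of_sq_le
    rw [norm_sub_rev]
    calc ‖xstar - xmin (y (k + 1))‖ ^ 2
        = 2 / μ * (μ / 2 * ‖xstar - xmin (y (k + 1))‖ ^ 2) := by field_simp
      _ ≤ _ := mul_le_mul_of_nonneg_left (hdist k) (by positivity)
  · intro ybar hcl w
    refine le_trans ?_ (hweak w)
    by_contra hcon
    push Not at hcon
    obtain ⟨c, hc1, hc2⟩ := EReal.lt_iff_exists_real_btwn.1 hcon
    have hev := lsc_dual f g A ⟨hfp, hfb⟩ ⟨hgp, hgb⟩ ybar c hc2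
    have hfr : ∃ᶠ k in atTop, (c : EReal) < dualObj f g A (y k) := hcl.frequently hev
    norm_cast at hc1
    have hF2 : ∀ᶠ k in atTop, F k < c := hFlim.eventually (gt_mem_nhds hc1)
    have hF3 : ∀ᶠ k in atTop, dualObj f g A (y k) < c := by
      obtain ⟨K, hK⟩ := eventually_atTop.1 hF2
      refine eventually_atTop.2 ⟨K + 1, fun k hk => ?_⟩
      obtain ⟨j, rfl⟩ : ∃ j, k = j + 1 := ⟨k - 1, by omega⟩
      refine (hup j).trans_lt ?_
      exact_mod_cast hK j (by omega)
    obtain ⟨k, h1, h2⟩ := (hfr.and_eventually hF3).exists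
    exact lt_asymm h1 h2
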